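/- Let φ_j : (a,b) → ℝ be continuous and Lebesgue integrable on (a,b) for j = 0, 1, …, 2N+1, let r : (a,b) → ℝ be continuous, strictly positive and integrable on (a,b), and set ψ_j(x) = φ_j(x)/r(x). Assume that each ψ_j has a finite limit as x → a, that the functions ψ_0, …, ψ_{2N+1} (extended continuously) form a Chebyshev system on [a,b], that ω is continuous and positive almost everywhere on (a,b), and that ω·r is integrable on (a,b). Then there exist unique nodes x_0 < x_1 < … < x_N in (a,b) and unique weights w_0, …, w_N, all strictly positive, such that ∫_a^b φ_j(x) ω(x) dx = Σ_{k=0}^{N} φ_j(x_k) w_k for every j = 0, 1, …, 2N+1. -/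

import Mathlib

open MeasureTheory

/-- A finite family of continuous functions `φ 0, …, φ (n-1)` on `[a,b]` is a Chebyshev system
if for every choice of pairwise distinct points in `[a,b]` the matrix `(φ i (x j))` has
nonzero determinant. -/
def IsChebyshevSystem (a b : ℝ) {n : ℕ} (φ : Fin n → ℝ → ℝ) : Prop :=
  (∀ i, ContinuousOn (φ i) (Set.Icc a b)) ∧
  ∀ x : Fin n → ℝ, (∀ i, x i ∈ Set.Icc a b) → Function.Injective x →
    (Matrix.of fun i j => φ i (x j)).det ≠ 0

namespace IsChebyshevSystem

open Filter Topology

variable {a b : ℝ}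

/-- Coefficient vector of the generalized polynomial vanishing at all the points `z j`. -/
noncomputable def nodalCoeff {n : ℕ} (u : Fin (n + 1) → ℝ → ℝ) (z : Fin n → ℝ) :
    Fin (n + 1) → ℝ :=
  fun i => (-1) ^ (i : ℕ) * (Matrix.of fun i' j' => u (i.succAbove i') (z j')).det

theorem det_eq_nodalCoeff {n : ℕ} (u : Fin (n + 1) → ℝ → ℝ) (w : Fin (n + 1) → ℝ)
    (j : Fin (n + 1)) :
    (Matrix.of fun i k => u i (w k)).det =
      (-1) ^ (j : ℕ) * (nodalCoeff u (fun k => w (j.succAbove k)) ⬝ᵥ fun i => u i (w j)) := by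
  rw [Matrix.det_succ_column _ j, dotProduct, Finset.mul_sum]
  refine Finset.sum_congr rfl fun i _ => ?_
  have : ((Matrix.of fun i k => u i (w k)).submatrix i.succAbove j.succAbove) =
      Matrix.of fun i' j' => u (i.succAbove i') (w (j.succAbove j')) := rfl
  rw [this, nodalCoeff, Matrix.of_apply, pow_add]
  ring

theorem nodalCoeff_dotProduct_eq_zero {n : ℕ} (u : Fin (n + 1) → ℝ → ℝ) (z : Fin n → ℝ)
    (k : Fin n) : (nodalCoeff u z ⬝ᵥ fun i => u i (z k)) = 0 := by
  have h := det_eq_nodalCoeff u (Fin.cons (z k) z) 0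
  have h2 : (Matrix.of fun i l => u i ((Fin.cons (z k) z : Fin (n + 1) → ℝ) l)).det = 0 := by
    apply Matrix.det_zero_of_column_eq (i := 0) (j := k.succ) (Fin.succ_ne_zero k).symm
    intro i
    simp
  rw [h2] at h
  simpa using h.symm

/-- The alternating linear relation between the values of a generalized polynomial at `n + 2`
points. -/
theorem sum_alternating_det_mul {n : ℕ} (u : Fin (n + 1) → ℝ → ℝ) (t : Fin (n + 2) → ℝ)
    (c : Fin (n + 1) → ℝ) :
    ∑ k : Fin (n + 2), (-1) ^ (k : ℕ) * (c ⬝ᵥ fun i => u i (t k)) *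
      (Matrix.of fun i l => u i (t (k.succAbove l))).det = 0 := by
  let B : Matrix (Fin (n + 2)) (Fin (n + 2)) ℝ :=
    Matrix.of (Fin.cons (fun k => c ⬝ᵥ fun i => u i (t k)) (fun i k => u i (t k)))
  have hB : B.det = 0 := by
    rw [← Matrix.exists_vecMul_eq_zero_iff]
    refine ⟨Fin.cons 1 (-c), ?_, ?_⟩
    · intro h
      simpa using congrFun h 0
    · ext k
      simp [Matrix.vecMul, dotProduct, Fin.sum_univ_succ (n := n + 1), B]
  rw [Matrix.det_succ_row_zero] at hB
  exact hB

theorem exists_sign {n : ℕ} {u : Fin n → ℝ → ℝ} (hu : IsChebyshevSystem a b u) :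
    ∃ σ : ℝ, ∀ w : Fin n → ℝ, StrictMono w → (∀ i, w i ∈ Set.Icc a b) →
      0 < σ * (Matrix.of fun i j => u i (w j)).det := by
  let S : Set (Fin n → ℝ) := {w | StrictMono w ∧ ∀ i, w i ∈ Set.Icc a b}
  have hS : Convex ℝ S := by
    rintro w ⟨hw, hw'⟩ v ⟨hv, hv'⟩ p q hp hq hpq
    refine ⟨fun i j hij => ?_, fun i => (convex_Icc a b) (hw' i) (hv' i) hp hq hpq⟩
    have h1 := hw hij
    have h2 := hv hij
    simp only [Pi.add_apply, Pi.smul_apply, smul_eq_mul]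
    rcases hp.eq_or_lt with rfl | hp
    · have : q = 1 := by linarith
      subst this
      linarith
    · nlinarith
  have hcont : ContinuousOn (fun w : Fin n → ℝ => (Matrix.of fun i j => u i (w j)).det) S := by
    simp only [Matrix.det_apply, Matrix.of_apply]
    refine continuousOn_finsetSum _ fun τ _ => ContinuousOn.const_smul ?_ _
    refine continuousOn_finsetProd _ fun i _ => ?_
    exact (hu.1 _).comp (continuous_apply i).continuousOn fun w hw => hw.2 i
  have hne : ∀ w ∈ S, (Matrix.of fun i j => u i (w j)).det ≠ 0 :=
    fun w hw => hu.2 w hw.2 hw.1.injective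
  by_cases hex : ∃ w, w ∈ S
  · obtain ⟨w₀, hw₀⟩ := hex
    refine ⟨(Matrix.of fun i j => u i (w₀ j)).det, fun w hw hw' => ?_⟩
    by_contra hle
    rw [not_lt] at hle
    have h0 : ∃ v ∈ S, (Matrix.of fun i j => u i (v j)).det = 0 := by
      rcases mul_nonpos_iff.1 hle with h | h
      · exact hS.isPreconnected.intermediate_value ⟨hw, hw'⟩ hw₀ hcont ⟨h.2, h.1⟩
      · exact hS.isPreconnected.intermediate_value hw₀ ⟨hw, hw'⟩ hcont h
    obtain ⟨v, hv, hv0⟩ := h0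
    exact hne v hv hv0
  · exact ⟨0, fun w hw hw' => (hex ⟨w, hw, hw'⟩).elim⟩

theorem eq_zero_of_vanish {n : ℕ} {u : Fin n → ℝ → ℝ} (hu : IsChebyshevSystem a b u)
    {x : Fin n → ℝ} (hx : ∀ i, x i ∈ Set.Icc a b) (hinj : Function.Injective x)
    {c : Fin n → ℝ} (hc : ∀ j, (c ⬝ᵥ fun i => u i (x j)) = 0) : c = 0 :=
  Matrix.eq_zero_of_vecMul_eq_zero (hu.2 x hx hinj) (funext hc)

/-- Interpolation by generalized polynomials. -/
theorem exists_interpolant {n : ℕ} {u : Fin n → ℝ → ℝ} (hu : IsChebyshevSystem a b u)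
    {x : Fin n → ℝ} (hx : ∀ i, x i ∈ Set.Icc a b) (hinj : Function.Injective x)
    (f : Fin n → ℝ) : ∃ c : Fin n → ℝ, ∀ j, (c ⬝ᵥ fun i => u i (x j)) = f j := by
  have hdet := hu.2 x hx hinj
  refine ⟨Matrix.vecMul f (Matrix.of fun i j => u i (x j))⁻¹, fun j => ?_⟩
  have h : Matrix.vecMul (Matrix.vecMul f (Matrix.of fun i j => u i (x j))⁻¹)
      (Matrix.of fun i j => u i (x j)) = f := by
    rw [Matrix.vecMul_vecMul, Matrix.nonsing_inv_mul _ (isUnit_iff_ne_zero.2 hdet),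
      Matrix.vecMul_one]
  exact congrFun h j

/-- A nonnegative generalized polynomial vanishing at every other one of `2 * N + 3` increasing
points is zero. -/
theorem eq_zero_of_nonneg_of_vanish_even {N : ℕ} {u : Fin (2 * N + 2) → ℝ → ℝ}
    (hu : IsChebyshevSystem a b u) {t : Fin (2 * N + 3) → ℝ} (ht : StrictMono t)
    (htI : ∀ k, t k ∈ Set.Icc a b) {c : Fin (2 * N + 2) → ℝ}
    (hc : ∀ k, 0 ≤ c ⬝ᵥ fun i => u i (t k))
    (hz : ∀ k : Fin (2 * N + 3), Even (k : ℕ) → (c ⬝ᵥ fun i => u i (t k)) = 0) : c = 0 := by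
  obtain ⟨σ, hσ⟩ := hu.exists_sign
  have hD : ∀ k : Fin (2 * N + 3),
      0 < σ * (Matrix.of fun i l => u i (t (k.succAbove l))).det := fun k =>
    hσ (fun l => t (k.succAbove l)) (ht.comp (Fin.strictMono_succAbove k)) fun l => htI _
  have h := sum_alternating_det_mul u t c
  have h2 : ∑ k : Fin (2 * N + 3), (c ⬝ᵥ fun i => u i (t k)) *
      (σ * (Matrix.of fun i l => u i (t (k.succAbove l))).det) = 0 := by
    rw [← neg_eq_zero, ← mul_zero σ, ← h, Finset.mul_sum, ← Finset.sum_neg_distrib]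
    refine Finset.sum_congr rfl fun k _ => ?_
    rcases Nat.even_or_odd (k : ℕ) with hk | hk
    · rw [hz k hk]; ring
    · rw [hk.neg_one_pow]; ring
  rw [Finset.sum_eq_zero_iff_of_nonneg fun k _ => mul_nonneg (hc k) (hD k).le] at h2
  refine hu.eq_zero_of_vanish (x := fun i : Fin (2 * N + 2) => t i.castSucc)
    (fun i => htI _) (ht.injective.comp (Fin.castSucc_injective _)) fun j => ?_
  exact (mul_eq_zero.1 (h2 j.castSucc (Finset.mem_univ _))).resolve_right (hD _).ne'

/-- A nonzero generalized polynomial that is nonnegative on an interval has at most `N + 1`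
zeros in it. -/
theorem card_zeros_le {N : ℕ} {u : Fin (2 * N + 2) → ℝ → ℝ}
    (hu : IsChebyshevSystem a b u) {ξ : ℝ} (hξ : a ≤ ξ) {c : Fin (2 * N + 2) → ℝ} (hc0 : c ≠ 0)
    (hc : ∀ t ∈ Set.Icc ξ b, 0 ≤ c ⬝ᵥ fun i => u i t) (Z : Finset ℝ)
    (hZ : ∀ t ∈ Z, t ∈ Set.Icc ξ b ∧ (c ⬝ᵥ fun i => u i t) = 0) : Z.card ≤ N + 1 := by
  by_contra hcard
  obtain ⟨Y, hYZ, hY⟩ := Finset.exists_subset_card_eq (show N + 2 ≤ Z.card by omega)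
  let y := Y.orderEmbOfFin hY
  have hyY : ∀ i, y i ∈ Z := fun i => hYZ (Y.orderEmbOfFin_mem hY i)
  let t : Fin (2 * N + 3) → ℝ := fun k =>
    (y ⟨k / 2, by omega⟩ + y ⟨(k + 1) / 2, by omega⟩) / 2
  have htI : ∀ k, t k ∈ Set.Icc ξ b := by
    intro k
    obtain ⟨h1, h2⟩ := (hZ _ (hyY ⟨k / 2, by omega⟩)).1
    obtain ⟨h3, h4⟩ := (hZ _ (hyY ⟨(k + 1) / 2, by omega⟩)).1
    constructor <;> simp only [t] <;> linarith
  refine hc0 (hu.eq_zero_of_nonneg_of_vanish_even (t := t) ?_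
    (fun k => ⟨hξ.trans (htI k).1, (htI k).2⟩) (fun k => hc _ (htI k)) fun k hk => ?_)
  · intro k l hkl
    have hkl' : (k : ℕ) < l := hkl
    have h1 : y ⟨k / 2, by omega⟩ ≤ y ⟨l / 2, by omega⟩ :=
      y.monotone (Fin.mk_le_mk.2 (by omega))
    have h2 : y ⟨(k + 1) / 2, by omega⟩ ≤ y ⟨(l + 1) / 2, by omega⟩ :=
      y.monotone (Fin.mk_le_mk.2 (by omega))
    have h3 : y ⟨k / 2, by omega⟩ < y ⟨l / 2, by omega⟩ ∨
        y ⟨(k + 1) / 2, by omega⟩ < y ⟨(l + 1) / 2, by omega⟩ := by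
      rcases Nat.even_or_odd' (k : ℕ) with ⟨q, hq | hq⟩
      · exact Or.inr (y.strictMono (Fin.mk_lt_mk.2 (by omega)))
      · exact Or.inl (y.strictMono (Fin.mk_lt_mk.2 (by omega)))
    simp only [t]
    rcases h3 with h3 | h3 <;> linarith
  · obtain ⟨q, hq⟩ := hk
    have : t k = y ⟨k / 2, by omega⟩ := by
      have h : (⟨((k : ℕ) + 1) / 2, by omega⟩ : Fin (N + 2)) = ⟨k / 2, by omega⟩ :=
        Fin.mk.injEq .. ▸ (by omega)
      simp only [t, h]
      ring
    rw [this]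
    exact (hZ _ (hyY _)).2

theorem nodalCoeff_sign {n : ℕ} {u : Fin (n + 1) → ℝ → ℝ} {σ : ℝ}
    (hσ : ∀ w : Fin (n + 1) → ℝ, StrictMono w → (∀ i, w i ∈ Set.Icc a b) →
      0 < σ * (Matrix.of fun i j => u i (w j)).det)
    {Z : Finset ℝ} (hZ : Z.card = n) (hZI : ∀ z ∈ Z, z ∈ Set.Icc a b) {t : ℝ}
    (ht : t ∈ Set.Icc a b) (htZ : t ∉ Z) :
    0 < σ * ((-1) ^ (Z.filter (· < t)).card *
      (nodalCoeff u (Z.orderEmbOfFin hZ) ⬝ᵥ fun i => u i t)) := by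
  have hW : (insert t Z).card = n + 1 := by rw [Finset.card_insert_of_notMem htZ, hZ]
  let w := (insert t Z).orderEmbOfFin hW
  have hwmem : ∀ i, w i ∈ insert t Z := fun i => Finset.orderEmbOfFin_mem _ hW i
  have hsurj : ∀ x ∈ insert t Z, ∃ i, w i = x := fun x hx => by
    have := Finset.range_orderEmbOfFin (insert t Z) hW
    rw [← Finset.mem_coe, ← this] at hx
    exact hx
  obtain ⟨j, hj⟩ := hsurj t (Finset.mem_insert_self _ _)
  have hz : (fun k => w (j.succAbove k)) = Z.orderEmbOfFin hZ := by
    refine Finset.orderEmbOfFin_unique hZ (fun k => ?_)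
      (w.strictMono.comp (Fin.strictMono_succAbove j))
    refine (Finset.mem_insert.1 (hwmem _)).resolve_left fun h => ?_
    exact Fin.succAbove_ne j k (w.injective (h.trans hj.symm))
  have hcard : (Z.filter (· < t)).card = j := by
    have : Z.filter (· < t) = (Finset.Iio j).map w.toEmbedding := by
      ext x
      simp only [Finset.mem_filter, Finset.mem_map, Finset.mem_Iio]
      constructor
      · rintro ⟨hx, hxt⟩
        obtain ⟨i, rfl⟩ := hsurj x (Finset.mem_insert_of_mem hx)
        exact ⟨i, w.lt_iff_lt.1 (hj ▸ hxt), rfl⟩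
      · rintro ⟨i, hi, rfl⟩
        have hlt : w i < t := hj ▸ w.strictMono hi
        exact ⟨(Finset.mem_insert.1 (hwmem i)).resolve_left hlt.ne, hlt⟩
    rw [this, Finset.card_map, Fin.card_Iio]
  have h := hσ w w.strictMono fun i => by
    rcases Finset.mem_insert.1 (hwmem i) with h | h
    · exact h ▸ ht
    · exact hZI _ h
  rwa [det_eq_nodalCoeff u w j, hz, hj, ← hcard] at h

/-- Compactness of the unit sphere: closed homogeneous half-space conditions that hold
eventually along a sequence of nonzero vectors hold for some nonzero vector. -/
theorem exists_limit_direction {n : ℕ} (c : ℕ → Fin n → ℝ) (hc : ∀ k, c k ≠ 0) :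
    ∃ d : Fin n → ℝ, d ≠ 0 ∧ ∀ v : Fin n → ℝ, (∀ᶠ k in atTop, 0 ≤ c k ⬝ᵥ v) → 0 ≤ d ⬝ᵥ v := by
  obtain ⟨d, hd, f, hf, hlim⟩ := (isCompact_sphere (0 : Fin n → ℝ) 1).tendsto_subseq
    (x := fun k => ‖c k‖⁻¹ • c k) fun k => by
      simp [norm_smul, inv_mul_cancel₀ (norm_ne_zero_iff.2 (hc k))]
  refine ⟨d, ?_, fun v hv => ?_⟩
  · rintro rfl
    simp at hd
  · have hcont : Continuous fun x : Fin n → ℝ => x ⬝ᵥ v := by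
      unfold dotProduct
      fun_prop
    refine ge_of_tendsto ((hcont.tendsto d).comp hlim) ?_
    filter_upwards [hf.tendsto_atTop.eventually hv] with k hk
    simp only [Function.comp_apply, smul_dotProduct, smul_eq_mul]
    positivity

theorem exists_nonneg_of_nodes {n : ℕ} {u : Fin (n + 1) → ℝ → ℝ}
    (hu : IsChebyshevSystem a b u) (hab : a < b) (Z : ℕ → Finset ℝ) (hZ : ∀ k, (Z k).card = n)
    (hZI : ∀ k, ∀ z ∈ Z k, z ∈ Set.Icc a b) (e : ℕ)
    (h : ∀ t ∈ Set.Icc a b, ∀ᶠ k in atTop, t ∉ Z k → Even (((Z k).filter (· < t)).card + e)) :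
    ∃ d : Fin (n + 1) → ℝ, d ≠ 0 ∧ (∀ t ∈ Set.Icc a b, 0 ≤ d ⬝ᵥ fun i => u i t) ∧
      ∀ t, (∀ k, t ∈ Z k) → (d ⬝ᵥ fun i => u i t) = 0 := by
  obtain ⟨σ, hσ⟩ := hu.exists_sign
  let c : ℕ → Fin (n + 1) → ℝ := fun k =>
    (σ * (-1) ^ e) • nodalCoeff u ((Z k).orderEmbOfFin (hZ k))
  have hczero : ∀ k, ∀ t ∈ Z k, (c k ⬝ᵥ fun i => u i t) = 0 := by
    intro k t ht
    rw [← Finset.mem_coe, ← Finset.range_orderEmbOfFin (Z k) (hZ k)] at ht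
    obtain ⟨i, rfl⟩ := ht
    simp only [c, smul_dotProduct, nodalCoeff_dotProduct_eq_zero, smul_zero]
  have hc : ∀ k, c k ≠ 0 := by
    intro k hk
    obtain ⟨t, ht, htZ⟩ := (Set.Icc_infinite hab).exists_notMem_finset (Z k)
    have h1 := nodalCoeff_sign hσ (hZ k) (hZI k) ht htZ
    have h2 : (c k ⬝ᵥ fun i => u i t) = 0 := by rw [hk, zero_dotProduct]
    simp only [c, smul_dotProduct, smul_eq_mul, mul_eq_zero, pow_eq_zero_iff', neg_eq_zero,
      one_ne_zero, false_and, or_false] at h2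
    rcases h2 with h2 | h2 <;> simp [h2] at h1
  obtain ⟨d, hd0, hd⟩ := exists_limit_direction c hc
  refine ⟨d, hd0, fun t ht => hd _ ?_, fun t ht => le_antisymm ?_ ?_⟩
  · filter_upwards [h t ht] with k hk
    by_cases htZ : t ∈ Z k
    · exact (hczero k t htZ).ge
    · have h1 := nodalCoeff_sign hσ (hZ k) (hZI k) ht htZ
      have h2 : ((-1 : ℝ) ^ e) = (-1) ^ ((Z k).filter (· < t)).card := by
        have := (hk htZ).neg_one_pow (α := ℝ)
        rw [pow_add] at this
        rcases neg_one_pow_eq_or ℝ e with h3 | h3 <;>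
          rw [h3] at this ⊢ <;> linarith
      simp only [c, smul_dotProduct, smul_eq_mul, h2]
      linarith
  · have := hd (-fun i => u i t) (.of_forall fun k => by
      rw [dotProduct_neg, hczero k t (ht k), neg_zero])
    rw [dotProduct_neg] at this
    linarith
  · exact hd _ (.of_forall fun k => (hczero k t (ht k)).ge)

/-- There is a nonzero nonnegative generalized polynomial with zeros at `N` prescribed interior
points and at an endpoint `p`. -/
theorem exists_nonneg_vanish {N : ℕ} {u : Fin (2 * N + 2) → ℝ → ℝ}
    (hu : IsChebyshevSystem a b u) (hab : a < b) {p : ℝ} (hp : p = a ∨ p = b)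
    (S : Finset ℝ) (hS : S.card = N) (hSI : ∀ s ∈ S, s ∈ Set.Ioo a b) :
    ∃ d : Fin (2 * N + 2) → ℝ, d ≠ 0 ∧ (∀ t ∈ Set.Icc a b, 0 ≤ d ⬝ᵥ fun i => u i t) ∧
      ∀ t ∈ insert p S, (d ⬝ᵥ fun i => u i t) = 0 := by
  classical
  have hpI : p ∈ Set.Icc a b := by
    rcases hp with rfl | rfl
    · exact Set.left_mem_Icc.2 hab.le
    · exact Set.right_mem_Icc.2 hab.le
  have hpS : p ∉ S := fun h => by
    have := hSI p h
    rcases hp with rfl | rfl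
    · exact this.1.false
    · exact this.2.false
  obtain ⟨e, he⟩ : ∃ e : ℕ, ∀ t ∈ Set.Icc a b, t ≠ p → Even ((if p < t then 1 else 0) + e) := by
    rcases hp with rfl | rfl
    · refine ⟨1, fun t ht htp => ?_⟩
      rw [if_pos (lt_of_le_of_ne ht.1 htp.symm)]
      decide
    · refine ⟨0, fun t ht htp => ?_⟩
      rw [if_neg ht.2.not_gt]
      decide
  have hpos : ∀ᶠ ε in 𝓝[>] (0 : ℝ), 0 < ε := self_mem_nhdsWithin
  have hlt : ∀ s t : ℝ, s < t → ∀ᶠ ε in 𝓝[>] (0 : ℝ), s + ε < t := fun s t hst => by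
    filter_upwards [Ioo_mem_nhdsGT (sub_pos.2 hst)] with ε hε
    linarith [hε.2]
  have hiff : ∀ t : ℝ, ∀ᶠ ε in 𝓝[>] (0 : ℝ), ∀ s ∈ S, s + ε < t ↔ s < t := fun t => by
    rw [Filter.eventually_all_finset]
    intro s _
    rcases lt_or_ge s t with h | h
    · filter_upwards [hlt s t h] with ε hε using iff_of_true hε h
    · filter_upwards [hpos] with ε hε using iff_of_false (by linarith) h.not_gt
  have hne : ∀ᶠ ε in 𝓝[>] (0 : ℝ), ∀ s' ∈ S, ∀ s ∈ S, s + ε ≠ s' := by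
    rw [Filter.eventually_all_finset]
    intro s' _
    rw [Filter.eventually_all_finset]
    intro s _
    rcases lt_or_ge s s' with h | h
    · filter_upwards [hlt s s' h] with ε hε using hε.ne
    · filter_upwards [hpos] with ε hε using by linarith
  have hb : ∀ᶠ ε in 𝓝[>] (0 : ℝ), ∀ s ∈ S, s + ε < b := by
    filter_upwards [hiff b] with ε hε s hs using (hε s hs).2 (hSI s hs).2
  obtain ⟨ε, hεlim, hε⟩ := Filter.exists_seq_forall_of_frequently
    (hpos.and (hne.and hb)).frequently
  let S' : ℕ → Finset ℝ := fun k => S.image (· + ε k)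
  have hS'I : ∀ k, ∀ s ∈ S' k, s ∈ Set.Ioo a b := by
    intro k s hs
    obtain ⟨r, hr, rfl⟩ := Finset.mem_image.1 hs
    exact ⟨by linarith [(hε k).1, (hSI r hr).1], (hε k).2.2 r hr⟩
  have hpS' : ∀ k, p ∉ S' k := fun k h => by
    have := hS'I k p h
    rcases hp with rfl | rfl
    · exact this.1.false
    · exact this.2.false
  have hdisj : ∀ k, Disjoint S (S' k) := fun k => by
    rw [Finset.disjoint_right]
    intro s hs hs'
    obtain ⟨r, hr, rfl⟩ := Finset.mem_image.1 hs
    exact (hε k).2.1 _ hs' r hr rfl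
  have hpU : ∀ k, p ∉ S ∪ S' k := fun k => by
    rw [Finset.mem_union, not_or]
    exact ⟨hpS, hpS' k⟩
  have hinj : ∀ k, Function.Injective (· + ε k) := fun k => add_left_injective _
  obtain ⟨d, hd0, hd, hdz⟩ := hu.exists_nonneg_of_nodes hab
    (fun k => insert p (S ∪ S' k)) (fun k => by
      rw [Finset.card_insert_of_notMem (hpU k), Finset.card_union_of_disjoint (hdisj k),
        Finset.card_image_of_injective _ (hinj k), hS]
      ring)
    (fun k z hz => by
      rcases Finset.mem_insert.1 hz with rfl | hz
      · exact hpI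
      rcases Finset.mem_union.1 hz with hz | hz
      · exact Set.Ioo_subset_Icc_self (hSI z hz)
      · exact Set.Ioo_subset_Icc_self (hS'I k z hz)) e
    (fun t ht => by
      filter_upwards [hεlim.eventually (hiff t)] with k hk htZ
      have h1 := he t ht fun h => htZ (h ▸ Finset.mem_insert_self _ _)
      have h2 : ((S' k).filter (· < t)).card = (S.filter (· < t)).card := by
        rw [Finset.filter_image, Finset.card_image_of_injective _ (hinj k),
          Finset.filter_congr hk]
      have h3 : ((S ∪ S' k).filter (· < t)).card = 2 * (S.filter (· < t)).card := by
        rw [Finset.filter_union, Finset.card_union_of_disjoint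
          (Finset.disjoint_filter_filter (hdisj k)), h2]
        ring
      rw [Finset.filter_insert]
      split_ifs at h1 ⊢ with hpt
      · rw [Finset.card_insert_of_notMem
          fun h => hpU k (Finset.mem_filter.1 h).1, h3, add_assoc]
        exact (even_two_mul _).add h1
      · rw [h3]
        rw [zero_add] at h1
        exact (even_two_mul _).add h1)
  refine ⟨d, hd0, hd, fun t ht => hdz t fun k => ?_⟩
  rcases Finset.mem_insert.1 ht with rfl | ht
  · exact Finset.mem_insert_self _ _
  · exact Finset.mem_insert_of_mem (Finset.mem_union_left _ ht)

theorem continuousOn_dotProduct {n : ℕ} {u : Fin n → ℝ → ℝ} (hu : IsChebyshevSystem a b u)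
    (c : Fin n → ℝ) : ContinuousOn (fun t => c ⬝ᵥ fun i => u i t) (Set.Icc a b) := by
  unfold dotProduct
  exact continuousOn_finsetSum _ fun i _ => (hu.1 i).const_mul (c i)

theorem exists_pos {N : ℕ} {u : Fin (2 * N + 2) → ℝ → ℝ}
    (hu : IsChebyshevSystem a b u) (hab : a < b) :
    ∃ c : Fin (2 * N + 2) → ℝ, ∀ t ∈ Set.Icc a b, 0 < c ⬝ᵥ fun i => u i t := by
  classical
  obtain ⟨S, hSI, hS⟩ := (Set.Ioo_infinite hab).exists_subset_card_eq N
  obtain ⟨S', hSI', hS'⟩ :=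
    ((Set.Ioo_infinite hab).sdiff S.finite_toSet).exists_subset_card_eq N
  have key : ∀ p ∈ Set.Icc a b, p ∉ Set.Ioo a b → ∀ (R : Finset ℝ), R.card = N →
      (∀ s ∈ R, s ∈ Set.Ioo a b) → ∀ d : Fin (2 * N + 2) → ℝ, d ≠ 0 →
      (∀ t ∈ Set.Icc a b, 0 ≤ d ⬝ᵥ fun i => u i t) →
      (∀ t ∈ insert p R, (d ⬝ᵥ fun i => u i t) = 0) →
      ∀ t ∈ Set.Icc a b, (d ⬝ᵥ fun i => u i t) = 0 → t ∈ insert p R := by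
    intro p hp hp' R hR hRI d hd0 hd hdz t ht htz
    by_contra htR
    have h := hu.card_zeros_le le_rfl hd0 hd (insert t (insert p R)) fun s hs => by
      rcases Finset.mem_insert.1 hs with rfl | hs
      · exact ⟨ht, htz⟩
      · refine ⟨?_, hdz s hs⟩
        rcases Finset.mem_insert.1 hs with rfl | hs
        · exact hp
        · exact Set.Ioo_subset_Icc_self (hRI s hs)
    rw [Finset.card_insert_of_notMem htR,
      Finset.card_insert_of_notMem fun h => hp' (hRI p h), hR] at h
    omega
  have hSI2 : ∀ s ∈ S, s ∈ Set.Ioo a b := fun s hs => hSI hs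
  have hSI2' : ∀ s ∈ S', s ∈ Set.Ioo a b := fun s hs => (hSI' hs).1
  obtain ⟨d, hd0, hd, hdz⟩ := hu.exists_nonneg_vanish hab (Or.inr rfl) S hS hSI2
  obtain ⟨d', hd0', hd', hdz'⟩ := hu.exists_nonneg_vanish hab (Or.inl rfl) S' hS' hSI2'
  refine ⟨d + d', fun t ht => ?_⟩
  rw [add_dotProduct]
  have h1 := hd t ht
  have h2 := hd' t ht
  refine lt_of_le_of_ne (add_nonneg h1 h2) fun h => ?_
  have m1 := key b (Set.right_mem_Icc.2 hab.le) (fun h => h.2.false) S hS hSI2 d hd0 hd hdz t ht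
    (by linarith)
  have m2 := key a (Set.left_mem_Icc.2 hab.le) (fun h => h.1.false) S' hS' hSI2' d' hd0' hd' hdz'
    t ht (by linarith)
  rcases Finset.mem_insert.1 m1 with rfl | m1 <;> rcases Finset.mem_insert.1 m2 with rfl | m2
  · exact hab.false
  · exact (hSI2' _ m2).2.false
  · exact (hSI2 _ m1).1.false
  · exact (hSI' m2).2 m1

/-- A linear functional that is strictly positive on nonzero nonnegative generalized polynomials
admits a right subinterval `[ξ, b]` on which it is positive but not strictly positive. -/
theorem exists_extremal_subinterval {N : ℕ} {u : Fin (2 * N + 2) → ℝ → ℝ}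
    (hu : IsChebyshevSystem a b u) (hab : a < b) {M : Fin (2 * N + 2) → ℝ}
    (hM : ∀ c : Fin (2 * N + 2) → ℝ, c ≠ 0 → (∀ t ∈ Set.Icc a b, 0 ≤ c ⬝ᵥ fun i => u i t) →
      0 < c ⬝ᵥ M) :
    ∃ ξ ∈ Set.Ioc a b,
      (∀ c : Fin (2 * N + 2) → ℝ, (∀ t ∈ Set.Icc ξ b, 0 ≤ c ⬝ᵥ fun i => u i t) → 0 ≤ c ⬝ᵥ M) ∧
      ∃ c : Fin (2 * N + 2) → ℝ, c ≠ 0 ∧ (∀ t ∈ Set.Icc ξ b, 0 ≤ c ⬝ᵥ fun i => u i t) ∧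
        c ⬝ᵥ M ≤ 0 := by
  obtain ⟨c₀, hc₀⟩ := hu.exists_pos hab
  let T : Set ℝ := {t | t ∈ Set.Icc a b ∧ ∀ c : Fin (2 * N + 2) → ℝ,
    (∀ s ∈ Set.Icc t b, 0 ≤ c ⬝ᵥ fun i => u i s) → 0 ≤ c ⬝ᵥ M}
  have haT : a ∈ T := by
    refine ⟨Set.left_mem_Icc.2 hab.le, fun c hc => ?_⟩
    rcases eq_or_ne c 0 with rfl | h
    · simp
    · exact (hM c h hc).le
  have hTb : BddAbove T := ⟨b, fun t ht => ht.1.2⟩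
  have hξI : sSup T ∈ Set.Icc a b := ⟨le_csSup hTb haT, csSup_le ⟨a, haT⟩ fun t ht => ht.1.2⟩
  set ξ := sSup T with hξ
  have hξT : ∀ c : Fin (2 * N + 2) → ℝ,
      (∀ t ∈ Set.Icc ξ b, 0 ≤ c ⬝ᵥ fun i => u i t) → 0 ≤ c ⬝ᵥ M := by
    intro c hc
    refine le_of_forall_pos_lt_add fun η hη => ?_
    obtain ⟨δ, hδ, hδη⟩ := exists_pos_mul_lt hη (c₀ ⬝ᵥ M)
    have hpos : ∀ t ∈ Set.Icc ξ b, 0 < (c + δ • c₀) ⬝ᵥ fun i => u i t := by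
      intro t ht
      rw [add_dotProduct, smul_dotProduct, smul_eq_mul]
      have h1 := hc t ht
      have h2 := mul_pos hδ (hc₀ t ⟨hξI.1.trans ht.1, ht.2⟩)
      linarith
    have hev : ∀ᶠ t in 𝓝[Set.Icc a b] ξ, 0 < (c + δ • c₀) ⬝ᵥ fun i => u i t :=
      (hu.continuousOn_dotProduct _ ξ hξI).eventually
        (lt_mem_nhds (hpos ξ (Set.left_mem_Icc.2 hξI.2)))
    rw [eventually_nhdsWithin_iff, Metric.eventually_nhds_iff] at hev
    obtain ⟨ρ, hρ, hev⟩ := hev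
    obtain ⟨t, htT, ht⟩ := exists_lt_of_lt_csSup ⟨a, haT⟩ (sub_lt_self ξ hρ)
    have hL := htT.2 (c + δ • c₀) fun s hs => by
      rcases le_or_gt ξ s with h | h
      · exact (hpos s ⟨h, hs.2⟩).le
      · refine (hev ?_ ⟨htT.1.1.trans hs.1, hs.2⟩).le
        rw [Real.dist_eq, abs_lt]
        constructor <;> linarith [hs.1]
    rw [add_dotProduct, smul_dotProduct, smul_eq_mul] at hL
    linarith
  have hc : ∃ c : Fin (2 * N + 2) → ℝ, c ≠ 0 ∧
      (∀ t ∈ Set.Icc ξ b, 0 ≤ c ⬝ᵥ fun i => u i t) ∧ c ⬝ᵥ M ≤ 0 := by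
    rcases hξI.2.eq_or_lt with hb | hb
    · obtain ⟨S, hSI, hS⟩ := (Set.Ioo_infinite hab).exists_subset_card_eq N
      obtain ⟨d, hd0, hd, hdz⟩ := hu.exists_nonneg_vanish hab (Or.inr rfl) S hS fun s hs => hSI hs
      refine ⟨-d, neg_ne_zero.2 hd0, fun t ht => ?_, ?_⟩
      · rw [hb, Set.Icc_self, Set.mem_singleton_iff] at ht
        rw [neg_dotProduct, ht, hdz b (Finset.mem_insert_self _ _), neg_zero]
      · rw [neg_dotProduct]
        linarith [hM d hd0 hd]
    · have hex : ∀ k : ℕ, ∃ c : Fin (2 * N + 2) → ℝ,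
          (∀ t ∈ Set.Icc (ξ + (b - ξ) / (k + 1)) b, 0 ≤ c ⬝ᵥ fun i => u i t) ∧ c ⬝ᵥ M < 0 := by
        intro k
        by_contra! hcon
        have hlt : 0 < (b - ξ) / (k + 1) := div_pos (by linarith) (by positivity)
        have hle : (b - ξ) / (k + 1) ≤ b - ξ :=
          div_le_self (by linarith) (by linarith [(Nat.cast_nonneg k : (0 : ℝ) ≤ k)])
        have := le_csSup hTb (show ξ + (b - ξ) / (k + 1) ∈ T from
          ⟨⟨by linarith [hξI.1], by linarith⟩, hcon⟩)
        linarith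
      choose c hcn hcM using hex
      obtain ⟨d, hd0, hd⟩ := exists_limit_direction c fun k hk => by
        have := hcM k
        simp [hk] at this
      have hdpos : ∀ t ∈ Set.Ioc ξ b, 0 ≤ d ⬝ᵥ fun i => u i t := by
        intro t ht
        have hlim : Tendsto (fun k : ℕ => ξ + (b - ξ) / ((k : ℝ) + 1)) atTop (𝓝 (ξ + 0)) :=
          tendsto_const_nhds.add (tendsto_const_div_atTop_nhds_zero_nat (b - ξ) |>.comp
            (tendsto_add_atTop_nat 1) |>.congr fun k => by simp)
        rw [add_zero] at hlim
        refine hd _ ?_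
        filter_upwards [hlim.eventually (gt_mem_nhds ht.1)] with k hk
        exact hcn k t ⟨hk.le, ht.2⟩
      refine ⟨d, hd0, fun t ht => ?_, ?_⟩
      · rcases ht.1.eq_or_lt with rfl | h
        · have hcont := (hu.continuousOn_dotProduct d).mono
            (Set.Icc_subset_Icc_left hξI.1 : Set.Icc ξ b ⊆ _) ξ (Set.left_mem_Icc.2 hb.le)
          have : (𝓝[Set.Ioc ξ b] ξ).NeBot := left_nhdsWithin_Ioc_neBot hb
          refine ge_of_tendsto (hcont.mono_left (nhdsWithin_mono ξ Set.Ioc_subset_Icc_self)) ?_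
          filter_upwards [self_mem_nhdsWithin] with s hs using hdpos s hs
        · exact hdpos t ⟨h, ht.2⟩
      · have := hd (-M) (.of_forall fun k => by
          rw [dotProduct_neg]
          linarith [hcM k])
        rw [dotProduct_neg] at this
        linarith
  refine ⟨ξ, ⟨lt_of_le_of_ne hξI.1 fun h => ?_, hξI.2⟩, hξT, hc⟩
  obtain ⟨c, hc0, hcn, hcM⟩ := hc
  rw [← h] at hcn
  exact (hM c hc0 hcn).not_ge hcM

/-- Nonnegativity on the zero set of an extremal polynomial suffices for positivity of the
functional. -/
theorem nonneg_of_nonneg_on_zeros {n : ℕ} {u : Fin n → ℝ → ℝ}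
    (hu : IsChebyshevSystem a b u) {c₀ : Fin n → ℝ}
    (hc₀ : ∀ t ∈ Set.Icc a b, 0 < c₀ ⬝ᵥ fun i => u i t) {M : Fin n → ℝ} {ξ : ℝ} (hξ : a ≤ ξ)
    (hL : ∀ c : Fin n → ℝ, (∀ t ∈ Set.Icc ξ b, 0 ≤ c ⬝ᵥ fun i => u i t) → 0 ≤ c ⬝ᵥ M)
    {c : Fin n → ℝ} (hc : ∀ t ∈ Set.Icc ξ b, 0 ≤ c ⬝ᵥ fun i => u i t) (hcM : c ⬝ᵥ M ≤ 0)
    {q : Fin n → ℝ}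
    (hq : ∀ t ∈ Set.Icc ξ b, (c ⬝ᵥ fun i => u i t) = 0 → 0 ≤ q ⬝ᵥ fun i => u i t) :
    0 ≤ q ⬝ᵥ M := by
  have hsub : Set.Icc ξ b ⊆ Set.Icc a b := Set.Icc_subset_Icc_left hξ
  refine le_of_forall_pos_lt_add fun η hη => ?_
  obtain ⟨δ, hδ, hδη⟩ := exists_pos_mul_lt hη (c₀ ⬝ᵥ M)
  set g := q + δ • c₀ with hg
  have hgcont := (hu.continuousOn_dotProduct g).mono hsub
  have hccont := (hu.continuousOn_dotProduct c).mono hsub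
  obtain ⟨B, hB⟩ := isCompact_Icc.exists_bound_of_continuousOn hgcont
  have hK : IsCompact (Set.Icc ξ b ∩ (fun t => g ⬝ᵥ fun i => u i t) ⁻¹' Set.Iic 0) :=
    isCompact_Icc.of_isClosed_subset
      (hgcont.preimage_isClosed_of_isClosed isClosed_Icc isClosed_Iic) Set.inter_subset_left
  obtain ⟨A, hA, hAg⟩ : ∃ A : ℝ, 0 ≤ A ∧ ∀ t ∈ Set.Icc ξ b,
      0 ≤ (A • c + g) ⬝ᵥ fun i => u i t := by
    simp only [add_dotProduct, smul_dotProduct, smul_eq_mul]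
    rcases Set.eq_empty_or_nonempty
      (Set.Icc ξ b ∩ (fun t => g ⬝ᵥ fun i => u i t) ⁻¹' Set.Iic 0) with hempty | hne
    · refine ⟨0, le_rfl, fun t ht => ?_⟩
      by_contra! hlt
      have : t ∈ Set.Icc ξ b ∩ (fun t => g ⬝ᵥ fun i => u i t) ⁻¹' Set.Iic 0 :=
        ⟨ht, by simp only [Set.mem_preimage, Set.mem_Iic]; linarith⟩
      rw [hempty] at this
      exact this
    · obtain ⟨s, ⟨hsI, hs⟩, hmin⟩ := hK.exists_isMinOn hne (hccont.mono Set.inter_subset_left)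
      have hspos : 0 < c ⬝ᵥ fun i => u i s := by
        refine lt_of_le_of_ne (hc s hsI) fun h => ?_
        have h1 := hq s hsI h.symm
        have h2 := mul_pos hδ (hc₀ s (hsub hsI))
        simp only [Set.mem_preimage, Set.mem_Iic, hg, add_dotProduct, smul_dotProduct,
          smul_eq_mul] at hs
        linarith
      have hB0 : 0 ≤ B := (norm_nonneg _).trans (hB s hsI)
      refine ⟨B / (c ⬝ᵥ fun i => u i s), by positivity, fun t ht => ?_⟩
      rcases le_or_gt (g ⬝ᵥ fun i => u i t) 0 with h | h
      · have h1 : (c ⬝ᵥ fun i => u i s) ≤ c ⬝ᵥ fun i => u i t := hmin ⟨ht, h⟩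
        have h2 := mul_le_mul_of_nonneg_left h1 (div_nonneg hB0 hspos.le)
        rw [div_mul_cancel₀ _ hspos.ne'] at h2
        have h3 := hB t ht
        rw [Real.norm_eq_abs] at h3
        linarith [neg_abs_le (g ⬝ᵥ fun i => u i t)]
      · have := mul_nonneg (div_nonneg hB0 hspos.le) (hc t ht)
        linarith
  have h := hL _ hAg
  rw [hg, add_dotProduct, add_dotProduct, smul_dotProduct, smul_dotProduct, smul_eq_mul,
    smul_eq_mul] at h
  nlinarith [mul_nonneg hA (neg_nonneg.2 hcM)]

theorem exists_nonneg_vanish_of_card_le {N : ℕ} {u : Fin (2 * N + 2) → ℝ → ℝ}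
    (hu : IsChebyshevSystem a b u) (hab : a < b) {p : ℝ} (hp : p = a ∨ p = b)
    (S : Finset ℝ) (hS : S.card ≤ N) (hSI : ∀ s ∈ S, s ∈ Set.Ioo a b) :
    ∃ d : Fin (2 * N + 2) → ℝ, d ≠ 0 ∧ (∀ t ∈ Set.Icc a b, 0 ≤ d ⬝ᵥ fun i => u i t) ∧
      ∀ t ∈ insert p S, (d ⬝ᵥ fun i => u i t) = 0 := by
  classical
  obtain ⟨R, hRI, hR⟩ :=
    ((Set.Ioo_infinite hab).sdiff S.finite_toSet).exists_subset_card_eq (N - S.card)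
  have hdisj : Disjoint S R := Finset.disjoint_right.2 fun x hx hxS => (hRI hx).2 hxS
  obtain ⟨d, hd0, hd, hdz⟩ := hu.exists_nonneg_vanish hab hp (S ∪ R)
    (by rw [Finset.card_union_of_disjoint hdisj]; omega)
    (fun s hs => (Finset.mem_union.1 hs).elim (hSI s) fun h => (hRI h).1)
  exact ⟨d, hd0, hd, fun t ht => hdz t (Finset.insert_subset_insert _
    Finset.subset_union_left ht)⟩

/-- A family of generalized polynomials dual to the evaluations at a small set of points. -/
theorem exists_dual_family {n m : ℕ} {u : Fin n → ℝ → ℝ} (hu : IsChebyshevSystem a b u)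
    (hab : a < b) (hmn : m ≤ n) {x : Fin m → ℝ} (hx : ∀ k, x k ∈ Set.Icc a b)
    (hinj : Function.Injective x) :
    ∃ q : Fin m → Fin n → ℝ, ∀ k l, (q k ⬝ᵥ fun i => u i (x l)) = if l = k then 1 else 0 := by
  classical
  let Z : Finset ℝ := Finset.univ.image x
  have hZ : Z.card = m := by
    rw [Finset.card_image_of_injective _ hinj, Finset.card_univ, Fintype.card_fin]
  obtain ⟨R, hRI, hR⟩ :=
    ((Set.Icc_infinite hab).sdiff Z.finite_toSet).exists_subset_card_eq (n - m)
  have hdisj : Disjoint Z R := Finset.disjoint_right.2 fun x hx hxS => (hRI hx).2 hxS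
  have hW : (Z ∪ R).card = n := by rw [Finset.card_union_of_disjoint hdisj]; omega
  have hWI : ∀ i, (Z ∪ R).orderEmbOfFin hW i ∈ Set.Icc a b := by
    intro i
    rcases Finset.mem_union.1 (Finset.orderEmbOfFin_mem _ hW i) with h | h
    · obtain ⟨k, _, hk⟩ := Finset.mem_image.1 h
      exact hk ▸ hx k
    · exact (hRI h).1
  choose q hq using fun k : Fin m => hu.exists_interpolant hWI
    ((Z ∪ R).orderEmbOfFin hW).injective
    fun j => if (Z ∪ R).orderEmbOfFin hW j = x k then 1 else 0
  refine ⟨q, fun k l => ?_⟩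
  have hl : x l ∈ ((Z ∪ R : Finset ℝ) : Set ℝ) :=
    Finset.mem_union_left _ (Finset.mem_image_of_mem x (Finset.mem_univ l))
  rw [← Finset.range_orderEmbOfFin _ hW] at hl
  obtain ⟨j, hj⟩ := hl
  rw [← hj, hq k j, hj]
  simp [hinj.eq_iff]

/-- Existence of a Gauss quadrature rule for a strictly positive linear functional. -/
theorem exists_quadrature {N : ℕ} {u : Fin (2 * N + 2) → ℝ → ℝ}
    (hu : IsChebyshevSystem a b u) (hab : a < b) {M : Fin (2 * N + 2) → ℝ}
    (hM : ∀ c : Fin (2 * N + 2) → ℝ, c ≠ 0 → (∀ t ∈ Set.Icc a b, 0 ≤ c ⬝ᵥ fun i => u i t) →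
      0 < c ⬝ᵥ M) :
    ∃ x w : Fin (N + 1) → ℝ, StrictMono x ∧ (∀ k, x k ∈ Set.Ioo a b) ∧ (∀ k, 0 < w k) ∧
      ∀ j, M j = ∑ k, u j (x k) * w k := by
  classical
  obtain ⟨c₀, hc₀⟩ := hu.exists_pos hab
  obtain ⟨ξ, hξ, hL, c, hc0, hc, hcM⟩ := hu.exists_extremal_subinterval hab hM
  let Zs : Set ℝ := {t | t ∈ Set.Icc ξ b ∧ (c ⬝ᵥ fun i => u i t) = 0}
  have hfin : Zs.Finite := by
    by_contra hinf
    obtain ⟨Y, hY, hYc⟩ := Set.Infinite.exists_subset_card_eq hinf (N + 2)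
    have := hu.card_zeros_le hξ.1.le hc0 hc Y fun t ht => hY ht
    omega
  let Z : Finset ℝ := hfin.toFinset
  have hmemZ : ∀ t, t ∈ Z ↔ t ∈ Set.Icc ξ b ∧ (c ⬝ᵥ fun i => u i t) = 0 := fun t =>
    hfin.mem_toFinset
  have hZle : Z.card ≤ N + 1 :=
    hu.card_zeros_le hξ.1.le hc0 hc Z fun t ht => (hmemZ t).1 ht
  have hF : ∀ q : Fin (2 * N + 2) → ℝ, (∀ t ∈ Z, 0 ≤ q ⬝ᵥ fun i => u i t) → 0 ≤ q ⬝ᵥ M :=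
    fun q hq => hu.nonneg_of_nonneg_on_zeros hc₀ hξ.1.le hL hc hcM fun t ht htz =>
      hq t ((hmemZ t).2 ⟨ht, htz⟩)
  have hF0 : ∀ q : Fin (2 * N + 2) → ℝ, (∀ t ∈ Z, (q ⬝ᵥ fun i => u i t) = 0) → q ⬝ᵥ M = 0 := by
    intro q hq
    refine le_antisymm ?_ (hF q fun t ht => (hq t ht).ge)
    have := hF (-q) fun t ht => by rw [neg_dotProduct, hq t ht, neg_zero]
    rw [neg_dotProduct] at this
    linarith
  have hinner : N + 1 ≤ (Z.filter (· ∈ Set.Ioo a b)).card := by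
    by_contra! hlt
    obtain ⟨d, hd0, hd, hdz⟩ := hu.exists_nonneg_vanish_of_card_le hab (Or.inr rfl)
      (Z.filter (· ∈ Set.Ioo a b)) (by omega) fun s hs => (Finset.mem_filter.1 hs).2
    refine (hM d hd0 hd).ne' (hF0 d fun t ht => hdz t ?_)
    have htI := ((hmemZ t).1 ht).1
    rcases htI.2.eq_or_lt with rfl | h
    · exact Finset.mem_insert_self _ _
    · exact Finset.mem_insert_of_mem
        (Finset.mem_filter.2 ⟨ht, hξ.1.trans_le htI.1, h⟩)
  have hZc : Z.card = N + 1 :=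
    le_antisymm hZle (hinner.trans (Finset.card_filter_le _ _))
  have hZI : ∀ t ∈ Z, t ∈ Set.Ioo a b := by
    have : Z.filter (· ∈ Set.Ioo a b) = Z :=
      Finset.eq_of_subset_of_card_le (Finset.filter_subset _ _) (hZle.trans hinner)
    intro t ht
    rw [← this] at ht
    exact (Finset.mem_filter.1 ht).2
  let x := Z.orderEmbOfFin hZc
  have hxZ : ∀ k, x k ∈ Z := fun k => Finset.orderEmbOfFin_mem _ hZc k
  have hsurj : ∀ t ∈ Z, ∃ k, x k = t := fun t ht => by
    rw [← Finset.mem_coe, ← Finset.range_orderEmbOfFin Z hZc] at ht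
    exact ht
  obtain ⟨q, hq⟩ := hu.exists_dual_family hab (show N + 1 ≤ 2 * N + 2 by omega)
    (fun k => Set.Ioo_subset_Icc_self (hZI _ (hxZ k))) x.injective
  have hrep : ∀ p : Fin (2 * N + 2) → ℝ,
      p ⬝ᵥ M = ∑ k, (p ⬝ᵥ fun i => u i (x k)) * (q k ⬝ᵥ M) := by
    intro p
    have h := hF0 (p - ∑ k, (p ⬝ᵥ fun i => u i (x k)) • q k) fun t ht => by
      obtain ⟨l, rfl⟩ := hsurj t ht
      simp [sub_dotProduct, sum_dotProduct, smul_dotProduct, hq]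
    simpa [sub_dotProduct, sum_dotProduct, smul_dotProduct, sub_eq_zero] using h
  have hw0 : ∀ k, 0 ≤ q k ⬝ᵥ M := fun k => hF _ fun t ht => by
    obtain ⟨l, rfl⟩ := hsurj t ht
    rw [hq]
    split_ifs <;> norm_num
  refine ⟨x, fun k => q k ⬝ᵥ M, x.strictMono, fun k => hZI _ (hxZ k),
    fun k => lt_of_le_of_ne (hw0 k) fun hk => ?_, fun j => ?_⟩
  · obtain ⟨d, hd0, hd, hdz⟩ := hu.exists_nonneg_vanish_of_card_le hab (Or.inr rfl)
      (Z.erase (x k)) (by rw [Finset.card_erase_of_mem (hxZ k)]; omega)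
      fun s hs => hZI s (Finset.mem_of_mem_erase hs)
    refine (hM d hd0 hd).ne' ?_
    rw [hrep d]
    refine Finset.sum_eq_zero fun l _ => ?_
    rcases eq_or_ne l k with rfl | hlk
    · rw [show q l ⬝ᵥ M = 0 from hk.symm, mul_zero]
    · rw [hdz (x l) (Finset.mem_insert_of_mem (Finset.mem_erase.2
        ⟨fun h => hlk (x.injective h), hxZ l⟩)), zero_mul]
  · have h := hrep (Pi.single j 1)
    simpa [single_dotProduct] using h

/-- Two quadrature rules, one of them with positive weights, whose total number of nodes does
not exceed the size of the system coincide as soon as they agree on the system. -/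
theorem quadrature_unique {n m : ℕ} {u : Fin n → ℝ → ℝ} (hu : IsChebyshevSystem a b u)
    (hab : a < b) (hmn : 2 * m ≤ n) {x y w v : Fin m → ℝ} (hx : StrictMono x)
    (hy : StrictMono y) (hxI : ∀ k, x k ∈ Set.Icc a b) (hyI : ∀ k, y k ∈ Set.Icc a b)
    (hw : ∀ k, 0 < w k)
    (h : ∀ j, ∑ k, u j (x k) * w k = ∑ k, u j (y k) * v k) : x = y ∧ w = v := by
  classical
  have hdot : ∀ c : Fin n → ℝ, ∑ k, (c ⬝ᵥ fun i => u i (x k)) * w k =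
      ∑ k, (c ⬝ᵥ fun i => u i (y k)) * v k := by
    intro c
    simp only [dotProduct, Finset.sum_mul]
    rw [Finset.sum_comm, Finset.sum_comm (s := Finset.univ (α := Fin m))]
    simp only [mul_assoc, ← Finset.mul_sum, h]
  let Z : Finset ℝ := Finset.univ.image x ∪ Finset.univ.image y
  have hZn : Z.card ≤ n := by
    refine (Finset.card_union_le _ _).trans ((add_le_add Finset.card_image_le
      Finset.card_image_le).trans ?_)
    simpa [two_mul] using hmn
  have hZI : ∀ t ∈ Z, t ∈ Set.Icc a b := by
    intro t ht
    rcases Finset.mem_union.1 ht with ht | ht <;> obtain ⟨k, _, rfl⟩ := Finset.mem_image.1 ht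
    exacts [hxI k, hyI k]
  obtain ⟨q, hq⟩ := hu.exists_dual_family hab hZn
    (fun k => hZI _ (Finset.orderEmbOfFin_mem Z rfl k)) (Z.orderEmbOfFin rfl).injective
  have hdual : ∀ s ∈ Z, ∃ c : Fin n → ℝ, ∀ t ∈ Z,
      (c ⬝ᵥ fun i => u i t) = if t = s then 1 else 0 := by
    have hsurj : ∀ t ∈ Z, ∃ k, Z.orderEmbOfFin rfl k = t := fun t ht => by
      rw [← Finset.mem_coe, ← Finset.range_orderEmbOfFin Z rfl] at ht
      exact ht
    intro s hs
    obtain ⟨k, rfl⟩ := hsurj s hs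
    refine ⟨q k, fun t ht => ?_⟩
    obtain ⟨l, rfl⟩ := hsurj t ht
    rw [hq]
    simp
  have hxZ : ∀ k, x k ∈ Z := fun k =>
    Finset.mem_union_left _ (Finset.mem_image_of_mem x (Finset.mem_univ k))
  have hyZ : ∀ k, y k ∈ Z := fun k =>
    Finset.mem_union_right _ (Finset.mem_image_of_mem y (Finset.mem_univ k))
  have hmass : ∀ s ∈ Z, ∑ k, (if x k = s then w k else 0) = ∑ k, if y k = s then v k else 0 := by
    intro s hs
    obtain ⟨c, hc⟩ := hdual s hs
    simpa [hc _ (hxZ _), hc _ (hyZ _)] using hdot c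
  have hxy : ∀ k, ∃ l, y l = x k := by
    intro k
    by_contra! hne
    have h1 := hmass (x k) (hxZ k)
    simp [hne, hx.injective.eq_iff] at h1
    exact (hw k).ne' h1
  have hxeq : x = y := by
    choose f hf using hxy
    have hfmono : StrictMono f := fun k l hkl => by
      rw [← hy.lt_iff_lt, hf, hf]
      exact hx hkl
    have hfid : f = id := by
      have hbij := Finite.injective_iff_bijective.1 hfmono.injective
      have := Subsingleton.elim (hfmono.orderIsoOfSurjective f hbij.2) (OrderIso.refl (Fin m))
      funext k
      exact DFunLike.congr_fun this k
    funext k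
    rw [← hf k, hfid, id]
  subst hxeq
  refine ⟨rfl, funext fun k => ?_⟩
  simpa [hx.injective.eq_iff] using hmass (x k) (hxZ k)

end IsChebyshevSystem

theorem generalized_gauss_quadrature_singular_endpoints
    (a b : ℝ) (hab : a < b) (N : ℕ)
    (φ : Fin (2 * N + 2) → ℝ → ℝ) (r : ℝ → ℝ) (ω : ℝ → ℝ)
    (hφcont : ∀ j, ContinuousOn (φ j) (Set.Ioo a b))
    (hφint : ∀ j, IntegrableOn (φ j) (Set.Ioo a b))
    (hrcont : ContinuousOn r (Set.Ioo a b))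
    (hrpos : ∀ x ∈ Set.Ioo a b, 0 < r x)
    (hrint : IntegrableOn r (Set.Ioo a b))
    -- each ψ_j = φ_j / r has a finite limit at `a`, and the continuous extensions of the
    -- ψ_j to `[a,b]` form a Chebyshev system on `[a,b]`
    (hlim : ∀ j, ∃ c : ℝ, Filter.Tendsto (fun x => φ j x / r x)
      (nhdsWithin a (Set.Ioo a b)) (nhds c))
    (hcheb : ∃ ψ : Fin (2 * N + 2) → ℝ → ℝ,
      (∀ j, ∀ x ∈ Set.Ioo a b, ψ j x = φ j x / r x) ∧ IsChebyshevSystem a b ψ)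
    (hωcont : ContinuousOn ω (Set.Ioo a b))
    (hωpos : ∀ᵐ x ∂(volume.restrict (Set.Ioo a b)), 0 < ω x)
    (hωrint : IntegrableOn (fun x => ω x * r x) (Set.Ioo a b)) :
    ∃! p : (Fin (N + 1) → ℝ) × (Fin (N + 1) → ℝ),
      StrictMono p.1 ∧ (∀ k, p.1 k ∈ Set.Ioo a b) ∧ (∀ k, 0 < p.2 k) ∧
      ∀ j, ∫ x in a..b, φ j x * ω x = ∑ k, φ j (p.1 k) * p.2 k := by
  obtain ⟨ψ, hψ, hu⟩ := hcheb
  have hφψ : ∀ j, ∀ x ∈ Set.Ioo a b, φ j x = ψ j x * r x := fun j x hx => by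
    rw [hψ j x hx, div_mul_cancel₀ _ (hrpos x hx).ne']
  have hint : ∀ j, IntegrableOn (fun x => ψ j x * (ω x * r x)) (Set.Ioo a b) := fun j => by
    rw [← integrableOn_Icc_iff_integrableOn_Ioo] at hωrint ⊢
    exact hωrint.continuousOn_mul (hu.1 j) isCompact_Icc
  set M : Fin (2 * N + 2) → ℝ := fun j => ∫ x in Set.Ioo a b, ψ j x * (ω x * r x) with hMdef
  have hmoment : ∀ j, ∫ x in a..b, φ j x * ω x = M j := fun j => by
    rw [intervalIntegral.integral_of_le hab.le, integral_Ioc_eq_integral_Ioo]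
    refine setIntegral_congr_fun measurableSet_Ioo fun x hx => ?_
    simp only [hφψ j x hx]
    ring
  have hM : ∀ c : Fin (2 * N + 2) → ℝ, c ≠ 0 →
      (∀ t ∈ Set.Icc a b, 0 ≤ c ⬝ᵥ fun i => ψ i t) → 0 < c ⬝ᵥ M := by
    intro c hc0 hc
    have hsum : c ⬝ᵥ M = ∫ x in Set.Ioo a b, (c ⬝ᵥ fun i => ψ i x) * (ω x * r x) := by
      simp only [dotProduct, hMdef, Finset.sum_mul, mul_assoc]
      rw [integral_finsetSum _ fun i _ => (hint i).const_mul (c i)]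
      simp only [integral_const_mul]
    have hintc : IntegrableOn (fun x => (c ⬝ᵥ fun i => ψ i x) * (ω x * r x)) (Set.Ioo a b) := by
      simp only [dotProduct, Finset.sum_mul, mul_assoc]
      exact integrable_finsetSum _ fun i _ => (hint i).const_mul (c i)
    have hnn : 0 ≤ᵐ[volume.restrict (Set.Ioo a b)]
        fun x => (c ⬝ᵥ fun i => ψ i x) * (ω x * r x) := by
      filter_upwards [hωpos, ae_restrict_mem measurableSet_Ioo] with x hx hxI
      exact mul_nonneg (hc x (Set.Ioo_subset_Icc_self hxI)) (mul_pos hx (hrpos x hxI)).le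
    rw [hsum]
    refine lt_of_le_of_ne (integral_nonneg_of_ae hnn) fun h => ?_
    have hae := (integral_eq_zero_iff_of_nonneg_ae hnn hintc).1 h.symm
    have hzero : ∀ᵐ x ∂volume.restrict (Set.Ioo a b), (c ⬝ᵥ fun i => ψ i x) = 0 := by
      filter_upwards [hae, hωpos, ae_restrict_mem measurableSet_Ioo] with x hx hxω hxI
      exact (mul_eq_zero.1 hx).resolve_right (mul_pos hxω (hrpos x hxI)).ne'
    rw [ae_restrict_iff' measurableSet_Ioo] at hzero
    have hfin : {x | x ∈ Set.Ioo a b ∧ (c ⬝ᵥ fun i => ψ i x) = 0}.Finite := by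
      by_contra hinf
      obtain ⟨Y, hY, hYc⟩ := Set.Infinite.exists_subset_card_eq hinf (N + 2)
      have := hu.card_zeros_le le_rfl hc0 hc Y fun t ht =>
        ⟨Set.Ioo_subset_Icc_self (hY ht).1, (hY ht).2⟩
      omega
    have hnull : volume (Set.Ioo a b) = 0 := by
      refine measure_eq_zero_iff_ae_notMem.2 ?_
      filter_upwards [hzero, measure_eq_zero_iff_ae_notMem.1 (hfin.measure_zero volume)]
        with x hx hx' hxI
      exact hx' ⟨hxI, hx hxI⟩
    rw [Real.volume_Ioo, ENNReal.ofReal_eq_zero] at hnull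
    linarith
  obtain ⟨x, w, hx, hxI, hw, hxw⟩ := hu.exists_quadrature hab hM
  refine ⟨(x, fun k => w k / r (x k)), ⟨hx, hxI, fun k => div_pos (hw k) (hrpos _ (hxI k)),
    fun j => ?_⟩, ?_⟩
  · rw [hmoment, hxw]
    refine Finset.sum_congr rfl fun k _ => ?_
    have := (hrpos _ (hxI k)).ne'
    rw [hφψ j _ (hxI k)]
    field_simp
  · rintro ⟨y, v⟩ ⟨hy, hyI, hv, hyv⟩
    dsimp only at hy hyI hv hyv
    obtain ⟨rfl, hwv⟩ := hu.quadrature_unique hab (show 2 * (N + 1) ≤ 2 * N + 2 by omega) hx hy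
      (fun k => Set.Ioo_subset_Icc_self (hxI k)) (fun k => Set.Ioo_subset_Icc_self (hyI k)) hw
      (v := fun k => r (y k) * v k) fun j => by
        rw [← hxw j, ← hmoment j, hyv j]
        refine Finset.sum_congr rfl fun k _ => ?_
        rw [hφψ j _ (hyI k), mul_assoc]
    refine Prod.ext rfl (funext fun k => ?_)
    simp only [hwv]
    rw [mul_div_cancel_left₀ _ (hrpos _ (hxI k)).ne']
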